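/- Let k ≥ 1 and n ≥ k. Define D(Z) = ∏_{a=2}^n ∏_{b=1}^{a−1} (1 − Z_a/Z_b)^{binom(n−2,k−1)}, D̃(Z;H) = ∏_{a=1}^n ∏_{b≠a} (1 − H·Z_a/Z_b)^{binom(n−2,k−2)}, and D̂(Z;H) = D(Z)·D(Z^{-1})·D̃(Z;H), where Z^{-1} = (Z_1^{-1},...,Z_n^{-1}). Then det( 𝒲⁰(H·Z_I; Z_{σ_J}; H) )_{I,J ∈ C(n,k)} = H^{−(n(n−1)/2)·binom(n−1,k−1)} · D̂(Z;H). -/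

import Mathlib

noncomputable section

open MvPolynomial

/-- The rational-function field `ℂ(Z₁,…,Z_n,H)`. -/
abbrev ZF (n : ℕ) : Type := FractionRing (MvPolynomial (Fin n ⊕ Unit) ℂ)

def ZV (n : ℕ) (a : Fin n) : ZF n :=
  algebraMap (MvPolynomial (Fin n ⊕ Unit) ℂ) (ZF n) (X (Sum.inl a))

def HV (n : ℕ) : ZF n :=
  algebraMap (MvPolynomial (Fin n ⊕ Unit) ℂ) (ZF n) (X (Sum.inr ()))

/-- The function `U(T;Z;H)` of formula (3.1). -/
def Ufun {F : Type*} [Field F] (n k : ℕ) (T : Fin k → F) (Z : Fin n → F)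
    (H : F) : F :=
  ∏ i : Fin k,
    ((∏ a ∈ Finset.univ.filter (fun a : Fin n => a.1 < i.1),
        (1 - H * Z a / T i)) *
     (∏ b ∈ Finset.univ.filter (fun b : Fin n => i.1 < b.1 ∧ b.1 < k),
        (1 - Z b / T i)) *
     (∏ j ∈ Finset.univ.filter (fun j : Fin k => i < j),
        ((1 - H * T j / T i) / (1 - T j / T i))))

/-- The reduced trigonometric weight function `𝒲(T;Z;H) = Sym_T U(T;Z;H)`. -/
def Wtrig {F : Type*} [Field F] (n k : ℕ) (T : Fin k → F) (Z : Fin n → F)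
    (H : F) : F :=
  ∑ σ : Equiv.Perm (Fin k), Ufun n k (T ∘ σ) Z H

/-- The trigonometric weight function
`𝒲⁰(T;Z;H) = 𝒲(T;Z;H) ∏_{i≤k} ∏_{a>k} (1 − Z_a/T_i)`. -/
def W0 {F : Type*} [Field F] (n k : ℕ) (T : Fin k → F) (Z : Fin n → F)
    (H : F) : F :=
  Wtrig n k T Z H *
    ∏ i : Fin k, ∏ a ∈ Finset.univ.filter (fun a : Fin n => k ≤ a.1),
      (1 - Z a / T i)

/-- `E(T;H) = ∏_i ∏_{j≠i} (1 − H·T_i/T_j)`. -/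
def Efun {F : Type*} [Field F] (k : ℕ) (T : Fin k → F) (H : F) : F :=
  ∏ i : Fin k, ∏ j ∈ Finset.univ.filter (fun j : Fin k => j ≠ i),
    (1 - H * T i / T j)

/-- `R(Z) = ∏_{a≤k} ∏_{b>k} (1 − Z_b/Z_a)`. -/
def Rfun {F : Type*} [Field F] (n k : ℕ) (Z : Fin n → F) : F :=
  ∏ a ∈ Finset.univ.filter (fun a : Fin n => a.1 < k),
    ∏ b ∈ Finset.univ.filter (fun b : Fin n => k ≤ b.1),
      (1 - Z b / Z a)

/-- The increasing enumeration of a `k`-element subset of `{1, …, n}`. -/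
def enum {n k : ℕ} (I : Finset (Fin n)) (hI : I.card = k) : Fin k → Fin n :=
  fun a => (I.orderIsoOfFin hI a : Fin n)

/-- The minimal-length permutation `σ_J` with `{σ_J(1),…,σ_J(k)} = J`. -/
def permOfSubset {n k : ℕ} (hk : k ≤ n) (J : Finset (Fin n)) (hJ : J.card = k) :
    Equiv.Perm (Fin n) :=
  (finCongr (Nat.add_sub_cancel' hk)).symm.trans <|
    finSumFinEquiv.symm.trans <|
      (Equiv.sumCongr (J.orderIsoOfFin hJ).toEquiv
          ((Jᶜ.orderIsoOfFin (by simp [Finset.card_compl, hJ])).toEquiv.trans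
            (Equiv.subtypeEquivRight fun x => Finset.mem_compl))).trans
        (Equiv.sumCompl (· ∈ J))


/-- The opposite trigonometric weight function
`𝒲^∞(T;Z;H) = H^{k(k−1)/2} 𝒲(T;Z;H) ∏_{i≤k} ∏_{a>k} (1 − H·Z_a/T_i)`. -/
def Winf {F : Type*} [Field F] (n k : ℕ) (T : Fin k → F) (Z : Fin n → F)
    (H : F) : F :=
  H ^ (k * (k - 1) / 2) * Wtrig n k T Z H *
    ∏ i : Fin k, ∏ a ∈ Finset.univ.filter (fun a : Fin n => k ≤ a.1),
      (1 - H * Z a / T i)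


/-- `D(Z) = ∏_{a>b} (1 − Z_a/Z_b)^{binom(n−2,k−1)}`. -/
def Dfun {F : Type*} [Field F] (n k : ℕ) (Z : Fin n → F) : F :=
  ∏ a : Fin n, ∏ b ∈ Finset.univ.filter (fun b : Fin n => b < a),
    (1 - Z a / Z b) ^ Nat.choose (n - 2) (k - 1)

/-- `D̃(Z;H) = ∏_a ∏_{b≠a} (1 − H·Z_a/Z_b)^{binom(n−2,k−2)}`, with the
exponent interpreted as `0` when `k = 1`. -/
def Dtil {F : Type*} [Field F] (n k : ℕ) (Z : Fin n → F) (H : F) : F :=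
  ∏ a : Fin n, ∏ b ∈ Finset.univ.filter (fun b : Fin n => b ≠ a),
    (1 - H * Z a / Z b) ^ (if k = 1 then 0 else Nat.choose (n - 2) (k - 2))

/-- `D̂(Z;H) = D(Z) D(Z⁻¹) D̃(Z;H)`. -/
def Dhat {F : Type*} [Field F] (n k : ℕ) (Z : Fin n → F) (H : F) : F :=
  Dfun n k Z * Dfun n k (fun a => (Z a)⁻¹) * Dtil n k Z H

open Finset in
theorem det_eq_prod_diag_of_grading {ι R : Type*} [Fintype ι] [DecidableEq ι] [CommRing R]
    (M : Matrix ι ι R) (b : ι → ℤ) (h : ∀ i j, M i j ≠ 0 → i = j ∨ b j < b i) :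
    M.det = ∏ i, M i i := by
  rw [Matrix.det_apply, Finset.sum_eq_single 1]
  · simp
  · intro σ _ hσ
    by_contra hne
    have hM : ∀ i, M (σ i) i ≠ 0 := by
      intro i hi
      have h0 : ∏ j, M (σ j) j = 0 := Finset.prod_eq_zero (Finset.mem_univ i) hi
      exact hne (by rw [h0, smul_zero])
    have hle : ∀ i ∈ (univ : Finset ι), b i ≤ b (σ i) := by
      intro i _
      rcases h _ _ (hM i) with h' | h'
      · rw [h']
      · exact h'.le
    have hsum : ∑ i, b i = ∑ i, b (σ i) := (Equiv.sum_comp σ b).symm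
    have heq := (Finset.sum_eq_sum_iff_of_le hle).1 hsum
    apply hσ
    ext i
    rcases h _ _ (hM i) with h' | h'
    · exact h'
    · exact absurd (heq i (mem_univ i)) h'.ne
  · simp

section WeightFunctions

variable {F : Type*} [Field F] {n k : ℕ}

/-- The one-variable factor attached to the site `c`. -/
def siteFactor (Z : Fin n → F) (H : F) (c : Fin n) (t : F) : F :=
  ∏ a : Fin n, if a < c then 1 - H * Z a / t else if c < a then 1 - Z a / t else 1

/-- The interaction of an ordered pair of variables. -/
def pairFactor (H s t : F) : F := (1 - H * t / s) / (1 - t / s)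

/-- The product of `pairFactor` over all ordered pairs of variables. -/
def interaction (H : F) (T : Fin k → F) : F :=
  ∏ p ∈ Finset.univ.filter (fun p : Fin k × Fin k => p.1 < p.2), pairFactor H (T p.1) (T p.2)

/-- The symmetrization of a product of one-variable functions against `interaction`. -/
def symProd (H : F) (φ : Fin k → F → F) (T : Fin k → F) : F :=
  ∑ σ : Equiv.Perm (Fin k), (∏ i, φ i (T (σ i))) * interaction H (T ∘ σ)

theorem prod_prod_filter_lt {M : Type*} [CommMonoid M] (f : Fin k → Fin k → M) :
    ∏ i, ∏ j ∈ Finset.univ.filter (fun j => i < j), f i j =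
      ∏ p ∈ Finset.univ.filter (fun p : Fin k × Fin k => p.1 < p.2), f p.1 p.2 := by
  rw [Finset.prod_filter, ← Finset.univ_product_univ, Finset.prod_product]
  simp only [Finset.prod_filter]

theorem W0_eq_symProd (hk : k ≤ n) (T : Fin k → F) (Z : Fin n → F) (H : F) :
    W0 n k T Z H = symProd H (fun i => siteFactor Z H (Fin.castLE hk i)) T := by
  unfold W0 Wtrig symProd
  rw [Finset.sum_mul]
  refine Finset.sum_congr rfl fun σ _ => ?_
  rw [← Equiv.prod_comp σ (fun i => ∏ a ∈ Finset.univ.filter (fun a : Fin n => k ≤ a.1),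
      (1 - Z a / T i))]
  unfold Ufun interaction
  rw [← prod_prod_filter_lt (fun i j => pairFactor H ((T ∘ σ) i) ((T ∘ σ) j)),
    ← Finset.prod_mul_distrib, ← Finset.prod_mul_distrib]
  refine Finset.prod_congr rfl fun i _ => ?_
  rw [mul_right_comm]
  congr 1
  simp only [Finset.prod_filter, ← Finset.prod_mul_distrib, siteFactor, Function.comp]
  refine Finset.prod_congr rfl fun a _ => ?_
  simp only [Fin.lt_def, Fin.val_castLE]
  have := i.2
  by_cases h1 : a.1 < i.1
  · have h2 : ¬ (i.1 < a.1) := by omega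
    have h3 : ¬ (k ≤ a.1) := by omega
    simp [h1, h2, h3]
  · by_cases h2 : i.1 < a.1
    · by_cases h3 : a.1 < k
      · simp [h1, h2, h3]
      · simp [h1, h2, h3, not_lt.1 h3]
    · have h3 : ¬ (k ≤ a.1) := by omega
      simp [h1, h2, h3]

/-- The part of `siteFactor` at `x` or `y` that is common to two adjacent sites `x`, `y`. -/
def commonFactor (Z : Fin n → F) (H : F) (x y : Fin n) (t : F) : F :=
  ∏ a ∈ (Finset.univ.erase x).erase y, if a < x then 1 - H * Z a / t else 1 - Z a / t

theorem siteFactor_left (Z : Fin n → F) (H : F) {x y : Fin n} (hxy : y.1 = x.1 + 1) (t : F) :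
    siteFactor Z H x t = (1 - Z y / t) * commonFactor Z H x y t := by
  have hne : y ≠ x := fun h => by simp [h] at hxy
  have hlt : x < y := by rw [Fin.lt_def]; omega
  unfold siteFactor commonFactor
  rw [← Finset.mul_prod_erase _ _ (Finset.mem_univ x),
    ← Finset.mul_prod_erase _ _ (Finset.mem_erase.2 ⟨hne, Finset.mem_univ y⟩)]
  simp only [lt_irrefl, if_false, one_mul, hlt, hlt.not_gt, if_true]
  congr 1
  refine Finset.prod_congr rfl fun a ha => ?_
  simp only [Finset.mem_erase] at ha
  rcases lt_trichotomy a x with h | h | h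
  · simp [h]
  · exact absurd h ha.2.1
  · simp [h, h.not_gt]

theorem siteFactor_right (Z : Fin n → F) (H : F) {x y : Fin n} (hxy : y.1 = x.1 + 1) (t : F) :
    siteFactor Z H y t = (1 - H * Z x / t) * commonFactor Z H x y t := by
  have hne : y ≠ x := fun h => by simp [h] at hxy
  have hlt : x < y := by rw [Fin.lt_def]; omega
  unfold siteFactor commonFactor
  rw [← Finset.mul_prod_erase _ _ (Finset.mem_univ x),
    ← Finset.mul_prod_erase _ _ (Finset.mem_erase.2 ⟨hne, Finset.mem_univ y⟩)]
  simp only [lt_irrefl, if_false, one_mul, hlt, if_true]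
  congr 1
  refine Finset.prod_congr rfl fun a ha => ?_
  simp only [Finset.mem_erase, Finset.mem_univ, and_true] at ha
  by_cases h : a < x
  · simp [h, h.trans hlt]
  · have h1 : ¬ a < y := by
      intro h'
      apply ha.2
      rw [Fin.lt_def] at h h'
      exact Fin.ext (by omega)
    have h2 : y < a := lt_of_le_of_ne (not_lt.1 h1) (Ne.symm ha.1)
    simp [h, h1, h2]

theorem commonFactor_comp_swap (Z : Fin n → F) (H : F) (x y : Fin n) (t : F) :
    commonFactor (Z ∘ Equiv.swap x y) H x y t = commonFactor Z H x y t := by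
  unfold commonFactor
  refine Finset.prod_congr rfl fun a ha => ?_
  simp only [Finset.mem_erase, Finset.mem_univ, and_true] at ha
  simp [Equiv.swap_apply_of_ne_of_ne ha.2 ha.1]

theorem siteFactor_comp_swap_of_ne (Z : Fin n → F) (H : F) {x y : Fin n}
    (hxy : y.1 = x.1 + 1) {c : Fin n} (hx : c ≠ x) (hy : c ≠ y) (t : F) :
    siteFactor (Z ∘ Equiv.swap x y) H c t = siteFactor Z H c t := by
  unfold siteFactor
  rw [← Equiv.prod_comp (Equiv.swap x y)]
  refine Finset.prod_congr rfl fun a _ => ?_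
  have hx' : c.1 ≠ x.1 := fun h => hx (Fin.ext h)
  have hy' : c.1 ≠ y.1 := fun h => hy (Fin.ext h)
  have h1 : Equiv.swap x y a < c ↔ a < c := by
    rw [Equiv.swap_apply_def]
    split_ifs with h h <;> simp only [Fin.lt_def] <;> grind
  have h2 : c < Equiv.swap x y a ↔ c < a := by
    rw [Equiv.swap_apply_def]
    split_ifs with h h <;> simp only [Fin.lt_def] <;> grind
  simp only [h1, h2, Function.comp, Equiv.swap_apply_self]

/-- A linear factor in `1 / t` expands in any two independent ones. -/
theorem exists_linear_factor_expand {v w : F} (h : v ≠ w) (z : F) :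
    ∃ α β : F, ∀ t : F, 1 - z / t = α * (1 - v / t) + β * (1 - w / t) := by
  refine ⟨(z - w) / (v - w), (v - z) / (v - w), fun t => ?_⟩
  have : v - w ≠ 0 := sub_ne_zero.2 h
  field_simp
  ring

theorem symProd_linear (H : F) (φ f g : Fin k → F → F) (i : Fin k) (α β : F) (T : Fin k → F)
    (hf : ∀ j, j ≠ i → f j = φ j) (hg : ∀ j, j ≠ i → g j = φ j)
    (hi : ∀ t, φ i t = α * f i t + β * g i t) :
    symProd H φ T = α * symProd H f T + β * symProd H g T := by
  unfold symProd
  rw [Finset.mul_sum, Finset.mul_sum, ← Finset.sum_add_distrib]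
  refine Finset.sum_congr rfl fun σ _ => ?_
  have key : ∀ ψ : Fin k → F → F, (∀ j, j ≠ i → ψ j = φ j) →
      ∏ j, ψ j (T (σ j)) = ψ i (T (σ i)) * ∏ j ∈ Finset.univ.erase i, φ j (T (σ j)) := by
    intro ψ hψ
    rw [← Finset.mul_prod_erase _ _ (Finset.mem_univ i)]
    congr 1
    exact Finset.prod_congr rfl fun j hj => by rw [hψ j (Finset.ne_of_mem_erase hj)]
  rw [key φ (fun _ _ => rfl), key f hf, key g hg, hi]
  ring

/-- Every pair of variables except the one at the positions `i`, `j`. -/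
def otherPairs (i j : Fin k) : Finset (Fin k × Fin k) :=
  (Finset.univ.filter (fun p : Fin k × Fin k => p.1 < p.2)).erase (i, j)

theorem prod_otherPairs_swap {i j : Fin k} (hij : j.1 = i.1 + 1) {M : Type*} [CommMonoid M]
    (f : Fin k → Fin k → M) :
    ∏ p ∈ otherPairs i j, f (Equiv.swap i j p.1) (Equiv.swap i j p.2) =
      ∏ p ∈ otherPairs i j, f p.1 p.2 := by
  refine Finset.prod_equiv ((Equiv.swap i j).prodCongr (Equiv.swap i j)) ?_ ?_
  · rintro ⟨a, b⟩
    simp only [otherPairs, Finset.mem_erase, Finset.mem_filter, Finset.mem_univ, true_and,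
      Equiv.prodCongr_apply, Prod.map, ne_eq, Prod.mk.injEq, Fin.lt_def, Fin.ext_iff,
      Equiv.swap_apply_def]
    split_ifs <;> simp_all <;> omega
  · intro p _
    rfl

theorem symProd_congr_of_adjacent (H : F) (φ ψ : Fin k → F → F) {i j : Fin k}
    (hij : j.1 = i.1 + 1) (hφ : ∀ l, l ≠ i → l ≠ j → φ l = ψ l) (T : Fin k → F)
    (h : ∀ a b, a ≠ b →
      φ i (T a) * φ j (T b) * pairFactor H (T a) (T b) +
        φ i (T b) * φ j (T a) * pairFactor H (T b) (T a) =
      ψ i (T a) * ψ j (T b) * pairFactor H (T a) (T b) +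
        ψ i (T b) * ψ j (T a) * pairFactor H (T b) (T a)) :
    symProd H φ T = symProd H ψ T := by
  have hne : j ≠ i := fun h => by simp [h] at hij
  have hlt : i < j := by rw [Fin.lt_def]; omega
  rw [← sub_eq_zero]
  unfold symProd
  rw [← Finset.sum_sub_distrib]
  set rest : Equiv.Perm (Fin k) → F := fun σ =>
    (∏ l ∈ (Finset.univ.erase i).erase j, ψ l (T (σ l))) *
      ∏ p ∈ otherPairs i j, pairFactor H (T (σ p.1)) (T (σ p.2)) with hrest
  have term : ∀ (χ : Fin k → F → F), (∀ l, l ≠ i → l ≠ j → χ l = ψ l) → ∀ σ : Equiv.Perm (Fin k),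
      (∏ l, χ l (T (σ l))) * interaction H (T ∘ σ) =
        (χ i (T (σ i)) * χ j (T (σ j)) * pairFactor H (T (σ i)) (T (σ j))) * rest σ := by
    intro χ hχ σ
    rw [← Finset.mul_prod_erase _ _ (Finset.mem_univ i),
      ← Finset.mul_prod_erase _ _ (Finset.mem_erase.2 ⟨hne, Finset.mem_univ j⟩)]
    have : ∏ l ∈ (Finset.univ.erase i).erase j, χ l (T (σ l)) =
        ∏ l ∈ (Finset.univ.erase i).erase j, ψ l (T (σ l)) := by
      refine Finset.prod_congr rfl fun l hl => ?_
      simp only [Finset.mem_erase, Finset.mem_univ, and_true] at hl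
      rw [hχ l hl.2 hl.1]
    rw [this]
    have hint : interaction H (T ∘ σ) = pairFactor H (T (σ i)) (T (σ j)) *
        ∏ p ∈ otherPairs i j, pairFactor H (T (σ p.1)) (T (σ p.2)) := by
      unfold interaction otherPairs
      rw [← Finset.mul_prod_erase _ _
        (Finset.mem_filter.2 ⟨Finset.mem_univ (i, j), hlt⟩)]
      rfl
    rw [hint, hrest]
    ring
  have rest_swap : ∀ σ, rest (σ * Equiv.swap i j) = rest σ := by
    intro σ
    simp only [hrest, Equiv.Perm.mul_apply]
    rw [prod_otherPairs_swap hij (fun a b => pairFactor H (T (σ a)) (T (σ b)))]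
    congr 1
    refine Finset.prod_congr rfl fun l hl => ?_
    simp only [Finset.mem_erase, Finset.mem_univ, and_true] at hl
    rw [Equiv.swap_apply_of_ne_of_ne hl.2 hl.1]
  refine Finset.sum_involution (fun σ _ => σ * Equiv.swap i j) ?_ ?_ ?_ ?_
  · intro σ _
    rw [term φ hφ, term ψ (fun _ _ _ => rfl), term φ hφ, term ψ (fun _ _ _ => rfl), rest_swap]
    simp only [Equiv.Perm.mul_apply, Equiv.swap_apply_left, Equiv.swap_apply_right]
    linear_combination rest σ * h (σ i) (σ j) (fun e => hne (σ.injective e).symm)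
  · intro σ _ _ he
    have := congrArg (fun τ : Equiv.Perm (Fin k) => τ i) he
    simp only [Equiv.Perm.mul_apply, Equiv.swap_apply_left] at this
    exact hne (σ.injective this)
  · intro σ _
    exact Finset.mem_univ _
  · intro σ _
    rw [mul_assoc, Equiv.swap_mul_self, mul_one]

/-- The exchange relation behind the symmetry of two occupied adjacent sites. -/
theorem adjacent_exchange (H : F) (x y : F) {s t : F} (hs : s ≠ 0) (ht : t ≠ 0) (hst : s ≠ t) :
    (1 - x / s) * (1 - H * y / t) * pairFactor H s t +
        (1 - x / t) * (1 - H * y / s) * pairFactor H t s =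
      (1 - y / s) * (1 - H * x / t) * pairFactor H s t +
        (1 - y / t) * (1 - H * x / s) * pairFactor H t s := by
  have h1 : s - t ≠ 0 := sub_ne_zero.2 hst
  have h2 : t - s ≠ 0 := sub_ne_zero.2 hst.symm
  have e1 : pairFactor H s t = (s - H * t) / (s - t) := by
    unfold pairFactor
    rw [one_sub_div hs, one_sub_div hs, div_div_div_cancel_right₀ hs]
  have e2 : pairFactor H t s = -(t - H * s) / (s - t) := by
    unfold pairFactor
    rw [one_sub_div ht, one_sub_div ht, div_div_div_cancel_right₀ ht, ← neg_sub s t, div_neg,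
      neg_div]
  rw [e1, e2]
  field_simp
  ring

/-- Tuples of distinct nonzero values of the variables. -/
abbrev GenericTuple (F : Type*) [Field F] (k : ℕ) : Type _ :=
  {T : Fin k → F // Function.Injective T ∧ ∀ i, T i ≠ 0}

/-- The weight function attached to the sites `K 0, …, K (k - 1)`. -/
def weightFun (Z : Fin n → F) (H : F) (K : Fin k → Fin n) (T : GenericTuple F k) : F :=
  symProd H (fun i => siteFactor Z H (K i)) T.1

/-- The span of the weight functions. -/
def weightSpan (k : ℕ) (Z : Fin n → F) (H : F) : Submodule F (GenericTuple F k → F) :=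
  Submodule.span F (Set.range fun K : {K : Fin k → Fin n // StrictMono K} => weightFun Z H K.1)

theorem weightFun_mem_weightSpan (Z : Fin n → F) (H : F) {K : Fin k → Fin n}
    (hK : StrictMono K) : weightFun Z H K ∈ weightSpan k Z H :=
  Submodule.subset_span ⟨⟨K, hK⟩, rfl⟩

theorem StrictMono.update_of_adjacent {K : Fin k → Fin n} (hK : StrictMono K) {i : Fin k}
    {y : Fin n} (hxy : y.1 = (K i).1 + 1 ∨ (K i).1 = y.1 + 1) (hy : ∀ j, K j ≠ y) :
    StrictMono (Function.update K i y) := by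
  intro a b hab
  have hKab := hK hab
  have ha := hy a
  have hb := hy b
  simp only [Function.update_apply]
  rw [ne_eq, Fin.ext_iff] at ha hb
  split_ifs with h1 h2 h2
  · subst h1 h2; exact absurd hab (lt_irrefl _)
  · subst h1; rw [Fin.lt_def] at *; omega
  · subst h2; rw [Fin.lt_def] at *; omega
  · exact hKab

/-- Moving one occupied site to an adjacent free one expresses a weight function with the two
parameters exchanged through those without the exchange. -/
theorem weightFun_comp_swap_mem_of_single (Z : Fin n → F) (H : F) {x y : Fin n}
    (hxy : y.1 = x.1 + 1) (hne : Z y ≠ H * Z x) {K : Fin k → Fin n} (hK : StrictMono K)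
    {c d : Fin n} (hcd : c = x ∧ d = y ∨ c = y ∧ d = x) {i : Fin k} (hi : K i = c)
    (hd : ∀ j, K j ≠ d) :
    weightFun (Z ∘ Equiv.swap x y) H K ∈ weightSpan k Z H := by
  have hK' : StrictMono (Function.update K i d) := by
    refine hK.update_of_adjacent ?_ hd
    rcases hcd with ⟨rfl, rfl⟩ | ⟨rfl, rfl⟩ <;> rw [hi] <;> simp [hxy]
  obtain ⟨α, β, h⟩ : ∃ α β : F, ∀ t, siteFactor (Z ∘ Equiv.swap x y) H c t =
      α * siteFactor Z H c t + β * siteFactor Z H d t := by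
    rcases hcd with ⟨rfl, rfl⟩ | ⟨rfl, rfl⟩
    · obtain ⟨α, β, h⟩ := exists_linear_factor_expand hne (Z c)
      refine ⟨α, β, fun t => ?_⟩
      rw [siteFactor_left _ _ hxy, siteFactor_left _ _ hxy, siteFactor_right _ _ hxy,
        commonFactor_comp_swap, Function.comp, Equiv.swap_apply_right, h]
      ring
    · obtain ⟨α, β, h⟩ := exists_linear_factor_expand hne.symm (H * Z c)
      refine ⟨α, β, fun t => ?_⟩
      rw [siteFactor_right _ _ hxy, siteFactor_left _ _ hxy, siteFactor_right _ _ hxy,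
        commonFactor_comp_swap, Function.comp, Equiv.swap_apply_left, h]
      ring
  have hother : ∀ j, j ≠ i → siteFactor Z H (K j) = siteFactor (Z ∘ Equiv.swap x y) H (K j) := by
    intro j hj
    have h1 : K j ≠ c := fun e => hj (hK.injective (e.trans hi.symm))
    have h2 := hd j
    funext t
    rcases hcd with ⟨rfl, rfl⟩ | ⟨rfl, rfl⟩
    · exact (siteFactor_comp_swap_of_ne Z H hxy h1 h2 t).symm
    · exact (siteFactor_comp_swap_of_ne Z H hxy h2 h1 t).symm
  have : weightFun (Z ∘ Equiv.swap x y) H K =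
      α • weightFun Z H K + β • weightFun Z H (Function.update K i d) := by
    funext T
    refine symProd_linear H _ _ _ i α β T.1 hother ?_ ?_
    · intro j hj
      rw [Function.update_of_ne hj]
      exact hother j hj
    · intro t
      rw [Function.update_self, hi, h]
  rw [this]
  exact add_mem (Submodule.smul_mem _ _ (weightFun_mem_weightSpan Z H hK))
    (Submodule.smul_mem _ _ (weightFun_mem_weightSpan Z H hK'))

theorem weightFun_comp_swap_mem (Z : Fin n → F) (H : F) {x y : Fin n}
    (hxy : y.1 = x.1 + 1) (hne : Z y ≠ H * Z x) {K : Fin k → Fin n} (hK : StrictMono K) :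
    weightFun (Z ∘ Equiv.swap x y) H K ∈ weightSpan k Z H := by
  by_cases hx : ∃ i, K i = x
  · obtain ⟨i, hi⟩ := hx
    by_cases hy : ∃ j, K j = y
    · obtain ⟨j, hj⟩ := hy
      have hlt : i < j := by
        rw [← hK.lt_iff_lt, hi, hj, Fin.lt_def]; omega
      have hij : j.1 = i.1 + 1 := by
        by_contra hcon
        have hl : i.1 + 1 < j.1 := by rw [Fin.lt_def] at hlt; omega
        have h1 : K i < K ⟨i.1 + 1, by omega⟩ := hK (by rw [Fin.lt_def]; simp)
        have h2 : K ⟨i.1 + 1, by omega⟩ < K j := hK (by rw [Fin.lt_def]; simpa using hl)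
        rw [hi, Fin.lt_def] at h1
        rw [hj, Fin.lt_def] at h2
        omega
      have : weightFun (Z ∘ Equiv.swap x y) H K = weightFun Z H K := by
        funext T
        refine symProd_congr_of_adjacent H _ _ hij ?_ T.1 ?_
        · intro l hli hlj
          funext t
          exact siteFactor_comp_swap_of_ne Z H hxy (fun e => hli (hK.injective (e.trans hi.symm)))
            (fun e => hlj (hK.injective (e.trans hj.symm))) t
        · intro a b hab
          simp only [hi, hj, siteFactor_left _ _ hxy, siteFactor_right _ _ hxy,
            commonFactor_comp_swap, Function.comp, Equiv.swap_apply_left, Equiv.swap_apply_right]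
          linear_combination commonFactor Z H x y (T.1 a) * commonFactor Z H x y (T.1 b) *
            adjacent_exchange H (Z x) (Z y) (T.2.2 a) (T.2.2 b) (fun e => hab (T.2.1 e))
      rw [this]
      exact weightFun_mem_weightSpan Z H hK
    · push Not at hy
      exact weightFun_comp_swap_mem_of_single Z H hxy hne hK (Or.inl ⟨rfl, rfl⟩) hi hy
  · push Not at hx
    by_cases hy : ∃ j, K j = y
    · obtain ⟨j, hj⟩ := hy
      exact weightFun_comp_swap_mem_of_single Z H hxy hne hK (Or.inr ⟨rfl, rfl⟩) hj hx
    · push Not at hy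
      have : weightFun (Z ∘ Equiv.swap x y) H K = weightFun Z H K := by
        funext T
        unfold weightFun
        congr 1
        funext i t
        exact siteFactor_comp_swap_of_ne Z H hxy (hx i) (hy i) t
      rw [this]
      exact weightFun_mem_weightSpan Z H hK

theorem weightSpan_comp_perm_le (k : ℕ) (Z : Fin n → F) (H : F)
    (hZ : ∀ a b, a ≠ b → Z b ≠ H * Z a) (σ : Equiv.Perm (Fin n)) :
    weightSpan k (Z ∘ σ) H ≤ weightSpan k Z H := by
  rcases n with _ | m
  · rw [Subsingleton.elim (Z ∘ σ) Z]
  have hσ : σ ∈ Submonoid.closure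
      (Set.range fun i : Fin m => Equiv.swap i.castSucc i.succ) := by
    rw [Equiv.Perm.mclosure_swap_castSucc_succ]
    exact Submonoid.mem_top σ
  induction hσ using Submonoid.closure_induction generalizing Z with
  | mem τ hτ =>
    obtain ⟨i, rfl⟩ := hτ
    refine Submodule.span_le.2 ?_
    rintro _ ⟨K, rfl⟩
    exact weightFun_comp_swap_mem Z H (by simp) (hZ _ _ (by simp [Fin.ext_iff])) K.2
  | one => exact le_rfl
  | mul τ ρ _ _ h1 h2 =>
    refine (h2 (Z ∘ τ) fun a b hab => hZ _ _ fun e => hab (τ.injective e)).trans ?_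
    exact h1 Z hZ

/-! ### Vanishing and diagonal values -/

theorem siteFactor_self_eq_zero (Z : Fin n → F) (H : F) {c a : Fin n} (h : c < a) (ha : Z a ≠ 0) :
    siteFactor Z H c (Z a) = 0 := by
  refine Finset.prod_eq_zero (Finset.mem_univ a) ?_
  simp [h, h.not_gt, div_self ha]

theorem siteFactor_scaled_eq_zero (Z : Fin n → F) {H : F} {c a : Fin n} (h : a < c)
    (ha : Z a ≠ 0) (hH : H ≠ 0) : siteFactor Z H c (H * Z a) = 0 := by
  refine Finset.prod_eq_zero (Finset.mem_univ a) ?_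
  simp [h, div_self (mul_ne_zero hH ha)]

theorem exists_perm_of_symProd_ne_zero {H : F} {φ : Fin k → F → F} {T : Fin k → F}
    (h : symProd H φ T ≠ 0) : ∃ σ : Equiv.Perm (Fin k), ∀ i, φ i (T (σ i)) ≠ 0 := by
  obtain ⟨σ, _, hσ⟩ := Finset.exists_ne_zero_of_sum_ne_zero h
  exact ⟨σ, fun i hi => hσ (by
    rw [Finset.prod_eq_zero (f := fun i => φ i (T (σ i))) (Finset.mem_univ i) hi, zero_mul])⟩

theorem symProd_eq_of_unique_perm {H : F} {φ : Fin k → F → F} {T : Fin k → F}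
    (h : ∀ σ : Equiv.Perm (Fin k), (∀ i, φ i (T (σ i)) ≠ 0) → σ = 1) :
    symProd H φ T = (∏ i, φ i (T i)) * interaction H T := by
  unfold symProd
  rw [Finset.sum_eq_single 1]
  · rfl
  · intro σ _ hσ
    have : ¬ ∀ i, φ i (T (σ i)) ≠ 0 := fun h' => hσ (h σ h')
    push Not at this
    obtain ⟨i, hi⟩ := this
    rw [Finset.prod_eq_zero (f := fun i => φ i (T (σ i))) (Finset.mem_univ i) hi, zero_mul]
  · simp

theorem perm_eq_one_of_le_apply (σ : Equiv.Perm (Fin k)) (h : ∀ i, i ≤ σ i) : σ = 1 := by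
  have hsum : ∑ i : Fin k, (i : ℕ) = ∑ i, (σ i : ℕ) :=
    (Equiv.sum_comp σ (fun i : Fin k => (i : ℕ))).symm
  have heq := (Finset.sum_eq_sum_iff_of_le (fun i _ => Fin.le_def.1 (h i))).1 hsum
  ext i
  exact (heq i (Finset.mem_univ i)).symm

theorem perm_eq_one_of_apply_le (σ : Equiv.Perm (Fin k)) (h : ∀ i, σ i ≤ i) : σ = 1 := by
  rw [← inv_eq_one]
  refine perm_eq_one_of_le_apply _ fun i => ?_
  simpa using h (σ⁻¹ i)

theorem eq_or_sum_lt_of_comp_perm_le {K L : Fin k → Fin n} (hK : StrictMono K) (hL : StrictMono L)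
    (σ : Equiv.Perm (Fin k)) (h : ∀ i, L (σ i) ≤ K i) :
    L = K ∨ ∑ i, ((L i : ℕ) : ℤ) < ∑ i, ((K i : ℕ) : ℤ) := by
  have hle : ∀ i ∈ Finset.univ, ((L (σ i) : ℕ) : ℤ) ≤ ((K i : ℕ) : ℤ) := by
    intro i _
    exact_mod_cast h i
  rw [← Equiv.sum_comp σ (fun i => ((L i : ℕ) : ℤ))]
  rcases (Finset.sum_le_sum hle).lt_or_eq with h' | h'
  · exact Or.inr h'
  · have heq := (Finset.sum_eq_sum_iff_of_le hle).1 h'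
    have hLK : ∀ i, L (σ i) = K i := fun i => Fin.ext (by exact_mod_cast heq i (Finset.mem_univ i))
    have hσ : StrictMono σ := fun a b hab => by
      rw [← hL.lt_iff_lt, hLK, hLK]
      exact hK hab
    have hone := perm_eq_one_of_le_apply σ fun i => hσ.le_apply
    left
    funext i
    simpa [hone] using hLK i

theorem eq_or_sum_lt_of_le_comp_perm {K L : Fin k → Fin n} (hK : StrictMono K) (hL : StrictMono L)
    (σ : Equiv.Perm (Fin k)) (h : ∀ i, K i ≤ L (σ i)) :
    L = K ∨ ∑ i, ((K i : ℕ) : ℤ) < ∑ i, ((L i : ℕ) : ℤ) := by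
  refine (eq_or_sum_lt_of_comp_perm_le hL hK σ⁻¹ fun i => ?_).imp_left Eq.symm
  simpa using h (σ⁻¹ i)

theorem symProd_siteFactor_self (Z : Fin n → F) (H : F) (hZ : ∀ a, Z a ≠ 0) {K : Fin k → Fin n}
    (hK : StrictMono K) :
    symProd H (fun i => siteFactor Z H (K i)) (Z ∘ K) =
      (∏ i, siteFactor Z H (K i) (Z (K i))) * interaction H (Z ∘ K) := by
  refine symProd_eq_of_unique_perm fun σ hσ => perm_eq_one_of_apply_le σ fun i => ?_
  by_contra hi
  exact hσ i (siteFactor_self_eq_zero Z H (hK (not_le.1 hi)) (hZ _))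

theorem interaction_scale {H : F} (hH : H ≠ 0) (T : Fin k → F) :
    interaction H (fun i => H * T i) = interaction H T := by
  refine Finset.prod_congr rfl fun p _ => ?_
  unfold pairFactor
  rw [mul_left_comm H H, mul_left_comm, mul_div_mul_left _ _ hH, mul_div_mul_left _ _ hH]

theorem symProd_siteFactor_scaled (Z : Fin n → F) {H : F} (hH : H ≠ 0) (hZ : ∀ a, Z a ≠ 0)
    {K : Fin k → Fin n} (hK : StrictMono K) :
    symProd H (fun i => siteFactor Z H (K i)) (fun i => H * Z (K i)) =
      (∏ i, siteFactor Z H (K i) (H * Z (K i))) * interaction H (Z ∘ K) := by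
  rw [← interaction_scale hH (Z ∘ K)]
  refine symProd_eq_of_unique_perm fun σ hσ => perm_eq_one_of_le_apply σ fun i => ?_
  by_contra hi
  exact hσ i (siteFactor_scaled_eq_zero Z (hK (not_le.1 hi)) (hZ _) hH)

/-! ### Products over pairs and over subsets -/

theorem prod_prod_offDiag {M : Type*} [CommMonoid M] (f g : Fin k → Fin k → M) :
    ∏ i, ∏ j, (if j < i then f i j else if i < j then g i j else 1) =
      ∏ p ∈ Finset.univ.filter (fun p : Fin k × Fin k => p.1 < p.2), (f p.2 p.1 * g p.1 p.2) := by
  rw [← prod_prod_filter_lt (fun i j => f j i * g i j)]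
  simp only [Finset.prod_filter]
  have : ∀ i j : Fin k, (if i < j then f j i * g i j else 1) =
      (if i < j then f j i else 1) * (if i < j then g i j else 1) := by
    intro i j
    split_ifs <;> simp
  simp only [this, Finset.prod_mul_distrib]
  rw [Finset.prod_comm (f := fun i j => if i < j then f j i else 1)]
  simp only [← Finset.prod_mul_distrib]
  refine Finset.prod_congr rfl fun i _ => Finset.prod_congr rfl fun j _ => ?_
  rcases lt_trichotomy i j with h | h | h
  · simp [h, h.not_gt]
  · simp [h]
  · simp [h, h.not_gt]

theorem prod_prod_ne {M : Type*} [CommMonoid M] (h : Fin k → Fin k → M) :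
    ∏ i, ∏ j ∈ Finset.univ.filter (fun j => j ≠ i), h i j =
      ∏ p ∈ Finset.univ.filter (fun p : Fin k × Fin k => p.1 < p.2), (h p.2 p.1 * h p.1 p.2) := by
  rw [← prod_prod_offDiag]
  simp only [Finset.prod_filter]
  refine Finset.prod_congr rfl fun i _ => Finset.prod_congr rfl fun j _ => ?_
  rcases lt_trichotomy i j with h | h | h
  · simp [h, h.not_gt, h.ne']
  · simp [h]
  · simp [h, h.ne]

theorem card_filter_fst_lt_snd (n : ℕ) :
    (Finset.univ.filter (fun p : Fin n × Fin n => p.1 < p.2)).card = n * (n - 1) / 2 := by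
  rw [Finset.card_filter, ← Finset.univ_product_univ, Finset.sum_product_right,
    ← Finset.sum_range_id, ← Fin.sum_univ_eq_sum_range (fun i => i)]
  refine Finset.sum_congr rfl fun j _ => ?_
  rw [← Finset.card_filter, Finset.filter_gt_eq_Iio, Fin.card_Iio]

theorem card_subsets_between {α : Type*} [Fintype α] [DecidableEq α] (A C : Finset α)
    (hAC : A ⊆ C) (hA : A.card ≤ k) :
    (Finset.univ.filter (fun J : {s : Finset α // s.card = k} => A ⊆ J.1 ∧ J.1 ⊆ C)).card =
      (C.card - A.card).choose (k - A.card) := by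
  rw [← Finset.card_sdiff_of_subset hAC, ← Finset.card_powersetCard]
  refine Finset.card_bij (fun J _ => J.1 \ A) ?_ ?_ ?_
  · intro J hJ
    simp only [Finset.mem_filter, Finset.mem_univ, true_and] at hJ
    rw [Finset.mem_powersetCard, Finset.card_sdiff_of_subset hJ.1, J.2]
    exact ⟨Finset.sdiff_subset_sdiff hJ.2 le_rfl, rfl⟩
  · intro J hJ J' hJ' h
    simp only [Finset.mem_filter, Finset.mem_univ, true_and] at hJ hJ'
    apply Subtype.ext
    rw [← Finset.sdiff_union_of_subset hJ.1, h, Finset.sdiff_union_of_subset hJ'.1]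
  · intro B hB
    rw [Finset.mem_powersetCard] at hB
    have hdisj : Disjoint B A :=
      Finset.disjoint_of_subset_left hB.1 Finset.sdiff_disjoint
    refine ⟨⟨B ∪ A, ?_⟩, ?_, ?_⟩
    · rw [Finset.card_union_of_disjoint hdisj, hB.2, Nat.sub_add_cancel hA]
    · simp only [Finset.mem_filter, Finset.mem_univ, true_and]
      exact ⟨Finset.subset_union_right,
        Finset.union_subset (hB.1.trans Finset.sdiff_subset) hAC⟩
    · exact Finset.union_sdiff_cancel_right hdisj

theorem card_subsets_containing (hk : 1 ≤ k) (i : Fin n) :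
    (Finset.univ.filter (fun J : {s : Finset (Fin n) // s.card = k} => i ∈ J.1)).card =
      (n - 1).choose (k - 1) := by
  have := card_subsets_between (k := k) {i} Finset.univ (Finset.subset_univ _) (by simpa using hk)
  simpa using this

theorem card_subsets_containing_pair (hk : 1 ≤ k) {i j : Fin n} (hij : j ≠ i) :
    (Finset.univ.filter
      (fun J : {s : Finset (Fin n) // s.card = k} => i ∈ J.1 ∧ j ∈ J.1)).card =
      if k = 1 then 0 else (n - 2).choose (k - 2) := by
  have hcard : ({i, j} : Finset (Fin n)).card = 2 := Finset.card_pair hij.symm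
  split_ifs with h
  · rw [Finset.card_eq_zero, Finset.filter_eq_empty_iff]
    rintro ⟨J, hJ⟩ _ ⟨hi, hj⟩
    have hle := Finset.card_le_card (show ({i, j} : Finset (Fin n)) ⊆ J by
      intro x hx
      simp only [Finset.mem_insert, Finset.mem_singleton] at hx
      rcases hx with rfl | rfl <;> assumption)
    omega
  · have := card_subsets_between (k := k) {i, j} Finset.univ (Finset.subset_univ _)
      (by omega)
    rw [hcard] at this
    simpa [Finset.insert_subset_iff] using this

theorem card_subsets_separating (hk : 1 ≤ k) {i j : Fin n} (hij : j ≠ i) :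
    (Finset.univ.filter
      (fun J : {s : Finset (Fin n) // s.card = k} => i ∈ J.1 ∧ j ∉ J.1)).card =
      (n - 2).choose (k - 1) := by
  have := card_subsets_between (k := k) {i} (Finset.univ.erase j)
    (by simpa using hij.symm) (by simpa using hk)
  rw [Finset.card_erase_of_mem (Finset.mem_univ j), Finset.card_singleton, Finset.card_univ,
    Fintype.card_fin, Nat.sub_sub] at this
  rw [← this]
  congr 1
  ext J
  simp only [Finset.mem_filter, Finset.mem_univ, true_and, Finset.singleton_subset_iff]
  refine and_congr_right fun _ => ⟨fun h x hx => ?_, fun h hj => ?_⟩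
  · simp only [Finset.mem_erase, Finset.mem_univ, and_true]
    rintro rfl
    exact h hx
  · simpa using h hj

theorem prod_prod_ite_eq_pow {ι κ M : Type*} [Fintype ι] [Fintype κ] [CommMonoid M]
    (P : ι → κ → Prop) [∀ J i, Decidable (P J i)] (h : κ → M) :
    ∏ J, ∏ i, (if P J i then h i else 1) =
      ∏ i, h i ^ (Finset.univ.filter (fun J => P J i)).card := by
  rw [Finset.prod_comm]
  refine Finset.prod_congr rfl fun i _ => ?_
  rw [← Finset.prod_filter, Finset.prod_const]

/-! ### Enumerations of subsets -/

theorem enum_strictMono (I : Finset (Fin n)) (hI : I.card = k) : StrictMono (enum I hI) :=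
  fun _ _ h => (I.orderIsoOfFin hI).strictMono h

theorem enum_mem (I : Finset (Fin n)) (hI : I.card = k) (i : Fin k) : enum I hI i ∈ I :=
  (I.orderIsoOfFin hI i).2

theorem prod_enum {M : Type*} [CommMonoid M] (I : Finset (Fin n)) (hI : I.card = k)
    (h : Fin n → M) : ∏ i, h (enum I hI i) = ∏ a ∈ I, h a := by
  rw [← Finset.prod_coe_sort I h]
  exact Equiv.prod_comp (I.orderIsoOfFin hI).toEquiv (fun a : I => h a)

theorem image_enum (I : Finset (Fin n)) (hI : I.card = k) :
    Finset.univ.image (enum I hI) = I := by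
  refine Finset.eq_of_subset_of_card_le ?_ ?_
  · intro a ha
    obtain ⟨i, _, rfl⟩ := Finset.mem_image.1 ha
    exact enum_mem I hI i
  · rw [Finset.card_image_of_injective _ (enum_strictMono I hI).injective, hI]
    simp

theorem enum_injective {I J : {s : Finset (Fin n) // s.card = k}}
    (h : enum I.1 I.2 = enum J.1 J.2) : I = J := by
  apply Subtype.ext
  rw [← image_enum I.1 I.2, h, image_enum]

theorem exists_eq_enum {K : Fin k → Fin n} (hK : StrictMono K) :
    ∃ I : {s : Finset (Fin n) // s.card = k}, enum I.1 I.2 = K := by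
  have hcard : (Finset.univ.image K).card = k := by
    rw [Finset.card_image_of_injective _ hK.injective]
    simp
  refine ⟨⟨Finset.univ.image K, hcard⟩, ?_⟩
  exact (Finset.orderEmbOfFin_unique hcard
    (fun i => Finset.mem_image_of_mem K (Finset.mem_univ i)) hK).symm

theorem permOfSubset_castLE (hk : k ≤ n) (J : Finset (Fin n)) (hJ : J.card = k) (i : Fin k) :
    permOfSubset hk J hJ (Fin.castLE hk i) = enum J hJ i := by
  have h : (finCongr (Nat.add_sub_cancel' hk)).symm (Fin.castLE hk i) =
      Fin.castAdd (n - k) i := by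
    ext; simp
  simp only [permOfSubset, Equiv.trans_apply, h, finSumFinEquiv_symm_apply_castAdd]
  rfl

theorem le_of_permOfSubset_notMem (hk : k ≤ n) (J : Finset (Fin n)) (hJ : J.card = k) (a : Fin n)
    (ha : permOfSubset hk J hJ a ∉ J) : k ≤ a.1 := by
  by_contra h
  apply ha
  have : a = Fin.castLE hk ⟨a.1, not_le.1 h⟩ := rfl
  rw [this, permOfSubset_castLE]
  exact enum_mem J hJ _

/-! ### Diagonal entries at `T = Z_J` -/

theorem symProd_permOfSubset_eq_zero (hk : k ≤ n) (Z : Fin n → F) (H : F) (hZ : ∀ a, Z a ≠ 0)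
    {I J : {s : Finset (Fin n) // s.card = k}} (hIJ : I ≠ J) :
    symProd H (fun i => siteFactor (Z ∘ permOfSubset hk J.1 J.2) H (Fin.castLE hk i))
      (fun i => Z (enum I.1 I.2 i)) = 0 := by
  by_contra hne
  obtain ⟨σ, hσ⟩ := exists_perm_of_symProd_ne_zero hne
  have hsub : ¬ I.1 ⊆ J.1 := fun h =>
    hIJ (Subtype.ext (Finset.eq_of_subset_of_card_le h (by rw [I.2, J.2])))
  obtain ⟨c, hcI, hcJ⟩ := Finset.not_subset.1 hsub
  rw [← image_enum I.1 I.2] at hcI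
  obtain ⟨j, _, rfl⟩ := Finset.mem_image.1 hcI
  set τ := permOfSubset hk J.1 J.2 with hτ
  have hlt : Fin.castLE hk (σ⁻¹ j) < τ⁻¹ (enum I.1 I.2 j) := by
    have := le_of_permOfSubset_notMem hk J.1 J.2 (τ⁻¹ (enum I.1 I.2 j)) (by
      rw [← hτ]; simpa using hcJ)
    rw [Fin.lt_def, Fin.val_castLE]
    omega
  have h0 := siteFactor_self_eq_zero (Z ∘ τ) H hlt (hZ _)
  apply hσ (σ⁻¹ j)
  simpa using h0

theorem one_sub_div_ne_zero {x y : F} (hy : y ≠ 0) (h : x ≠ y) : 1 - x / y ≠ 0 := by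
  rw [one_sub_div hy]
  exact div_ne_zero (sub_ne_zero.2 h.symm) hy

theorem symProd_permOfSubset_self (hk : k ≤ n) (Z : Fin n → F) (H : F) (hZ : ∀ a, Z a ≠ 0)
    (hinj : Function.Injective Z) (J : {s : Finset (Fin n) // s.card = k}) :
    symProd H (fun i => siteFactor (Z ∘ permOfSubset hk J.1 J.2) H (Fin.castLE hk i))
        (fun i => Z (enum J.1 J.2 i)) =
      (∏ i ∈ J.1, ∏ j ∈ J.1, if j ≠ i then 1 - H * Z i / Z j else 1) *
        ∏ i ∈ J.1, ∏ a ∈ J.1ᶜ, (1 - Z a / Z i) := by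
  set τ := permOfSubset hk J.1 J.2 with hτ
  set e := enum J.1 J.2 with he
  have hτe : ∀ i, τ (Fin.castLE hk i) = e i := permOfSubset_castLE hk J.1 J.2
  have hT : (fun i => Z (e i)) = (Z ∘ τ) ∘ Fin.castLE hk := by
    funext i
    simp [hτe]
  have heinj : Function.Injective e := (enum_strictMono J.1 J.2).injective
  rw [hT, symProd_siteFactor_self (Z ∘ τ) H (fun a => hZ _) (Fin.strictMono_castLE hk), ← hT]
  have hsite : ∀ i, siteFactor (Z ∘ τ) H (Fin.castLE hk i) ((Z ∘ τ) (Fin.castLE hk i)) =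
      (∏ j, if j < i then 1 - H * Z (e j) / Z (e i) else
        if i < j then 1 - Z (e j) / Z (e i) else 1) * ∏ a ∈ J.1ᶜ, (1 - Z a / Z (e i)) := by
    intro i
    unfold siteFactor
    rw [← Equiv.prod_comp τ⁻¹, ← Finset.prod_mul_prod_compl J.1]
    congr 1
    · rw [← prod_enum J.1 J.2]
      refine Finset.prod_congr rfl fun j _ => ?_
      have hlt : ∀ a b : Fin k, Fin.castLE hk a < Fin.castLE hk b ↔ a < b := fun _ _ => Iff.rfl
      have hinv : τ⁻¹ (e j) = Fin.castLE hk j := by simp [← hτe j]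
      simp only [← he, hinv, hlt, Function.comp, hτe]
    · refine Finset.prod_congr rfl fun a ha => ?_
      have hlt : Fin.castLE hk i < τ⁻¹ a := by
        have := le_of_permOfSubset_notMem hk J.1 J.2 (τ⁻¹ a) (by
          rw [← hτ]; simpa using ha)
        rw [Fin.lt_def, Fin.val_castLE]
        omega
      simp only [hlt, hlt.not_gt, if_true, if_false]
      simp [hτe]
  simp only [hsite, Finset.prod_mul_distrib]
  rw [← prod_enum J.1 J.2 (fun i => ∏ a ∈ J.1ᶜ, (1 - Z a / Z i)),
    ← prod_enum J.1 J.2 (fun i => ∏ j ∈ J.1, if j ≠ i then 1 - H * Z i / Z j else 1), mul_right_comm]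
  congr 1
  have hrhs : ∀ i, (∏ j ∈ J.1, if j ≠ e i then 1 - H * Z (e i) / Z j else 1) =
      ∏ j ∈ Finset.univ.filter (fun j => j ≠ i), (1 - H * Z (e i) / Z (e j)) := by
    intro i
    rw [← prod_enum J.1 J.2, Finset.prod_filter]
    refine Finset.prod_congr rfl fun j _ => ?_
    simp only [← he, heinj.ne_iff]
  simp only [← he, hrhs]
  rw [prod_prod_ne (fun i j => 1 - H * Z (e i) / Z (e j)),
    prod_prod_offDiag (fun i j => 1 - H * Z (e j) / Z (e i)) (fun i j => 1 - Z (e j) / Z (e i))]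
  unfold interaction
  rw [← Finset.prod_mul_distrib]
  refine Finset.prod_congr rfl fun p hp => ?_
  have hp' : p.1 < p.2 := (Finset.mem_filter.1 hp).2
  have h1 : 1 - Z (e p.2) / Z (e p.1) ≠ 0 :=
    one_sub_div_ne_zero (hZ _) fun h => hp'.ne' (heinj (hinj h))
  unfold pairFactor
  rw [mul_assoc, mul_div_cancel₀ _ h1, mul_comm]

/-! ### The determinants -/

theorem prod_siteFactor_scaled (Z : Fin n → F) {H : F} (hH : H ≠ 0) (hZ : ∀ a, Z a ≠ 0) :
    H ^ (n * (n - 1) / 2) * ∏ c, siteFactor Z H c (H * Z c) = ∏ c, siteFactor Z H c (Z c) := by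
  unfold siteFactor
  rw [prod_prod_offDiag (fun i j => 1 - H * Z j / (H * Z i)) (fun i j => 1 - Z j / (H * Z i)),
    prod_prod_offDiag (fun i j => 1 - H * Z j / Z i) (fun i j => 1 - Z j / Z i),
    ← card_filter_fst_lt_snd, ← Finset.prod_const, ← Finset.prod_mul_distrib]
  refine Finset.prod_congr rfl fun p _ => ?_
  have h1 := hZ p.1
  have h2 := hZ p.2
  field_simp
  ring

theorem prod_subsets_diag (hk1 : 1 ≤ k) (Z : Fin n → F) (H : F) :
    ∏ J : {s : Finset (Fin n) // s.card = k},
        ((∏ i ∈ J.1, ∏ j ∈ J.1, if j ≠ i then 1 - H * Z i / Z j else 1) *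
          ∏ i ∈ J.1, ∏ a ∈ J.1ᶜ, (1 - Z a / Z i)) = Dhat n k Z H := by
  have count : ∀ (P : {s : Finset (Fin n) // s.card = k} → Fin n × Fin n → Prop)
      [∀ J p, Decidable (P J p)] (h : Fin n → Fin n → F) (m : ℕ),
      (∀ i j, j ≠ i → (Finset.univ.filter (fun J => P J (i, j))).card = m) →
      ∏ J, ∏ i, ∏ j, (if j ≠ i then (if P J (i, j) then h i j else 1) else 1) =
        ∏ i, ∏ j ∈ Finset.univ.filter (fun j => j ≠ i), h i j ^ m := by
    intro P _ h m hm
    simp only [← Fintype.prod_prod_type' (f := fun i j => if j ≠ i then _ else (1 : F))]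
    rw [Finset.prod_comm]
    simp only [Finset.prod_filter]
    rw [← Fintype.prod_prod_type' (f := fun i j => if j ≠ i then h i j ^ m else (1 : F))]
    refine Finset.prod_congr rfl fun p _ => ?_
    by_cases hp : p.2 ≠ p.1
    · simp only [hp, if_true, ne_eq, not_false_eq_true]
      rw [← Finset.prod_filter, Finset.prod_const, hm _ _ hp]
    · simp [hp]
  rw [Finset.prod_mul_distrib]
  unfold Dhat
  rw [mul_comm]
  congr 1
  · have e1 : Dfun n k Z * Dfun n k (fun a => (Z a)⁻¹) =
        ∏ i, ∏ j ∈ Finset.univ.filter (fun j => j ≠ i),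
          (1 - Z j / Z i) ^ (n - 2).choose (k - 1) := by
      unfold Dfun
      rw [prod_prod_ne (fun i j => (1 - Z j / Z i) ^ (n - 2).choose (k - 1)),
        ← prod_prod_filter_lt (fun i j => (1 - Z i / Z j) ^ (n - 2).choose (k - 1) *
          (1 - Z j / Z i) ^ (n - 2).choose (k - 1)), ← Finset.prod_mul_distrib]
      simp only [← Finset.prod_mul_distrib, Finset.prod_filter]
      rw [Finset.prod_comm]
      refine Finset.prod_congr rfl fun i _ => Finset.prod_congr rfl fun j _ => ?_
      simp only [inv_div_inv]
      split_ifs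
      · rw [mul_comm]
      · simp
    rw [e1, ← count (fun J p => p.1 ∈ J.1 ∧ p.2 ∉ J.1) (fun i j => 1 - Z j / Z i) _
      (fun i j hij => card_subsets_separating hk1 hij)]
    refine Finset.prod_congr rfl fun J _ => ?_
    rw [← Finset.prod_subset (Finset.subset_univ J.1)]
    · refine Finset.prod_congr rfl fun i hi => ?_
      rw [← Finset.prod_subset (Finset.subset_univ J.1ᶜ)]
      · refine Finset.prod_congr rfl fun j hj => ?_
        have hj' : j ∉ J.1 := Finset.mem_compl.1 hj
        have : j ≠ i := fun h => hj' (h ▸ hi)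
        simp [hi, hj', this]
      · intro j _ hj
        simp only [Finset.mem_compl, not_not] at hj
        simp [hj]
    · intro i _ hi
      simp [hi]
  · unfold Dtil
    rw [← count (fun J p => p.1 ∈ J.1 ∧ p.2 ∈ J.1) (fun i j => 1 - H * Z i / Z j) _
      (fun i j hij => card_subsets_containing_pair hk1 hij)]
    refine Finset.prod_congr rfl fun J _ => ?_
    rw [← Finset.prod_subset (Finset.subset_univ J.1)]
    · refine Finset.prod_congr rfl fun i hi => ?_
      rw [← Finset.prod_subset (Finset.subset_univ J.1)]
      · refine Finset.prod_congr rfl fun j hj => ?_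
        simp [hi, hj]
      · intro j _ hj
        simp [hj]
    · intro i _ hi
      simp [hi]

/-- The matrix of weight functions evaluated at a family of tuples. -/
def weightMatrix (Z : Fin n → F) (H : F)
    (T : {s : Finset (Fin n) // s.card = k} → Fin k → F) :
    Matrix {s : Finset (Fin n) // s.card = k} {s : Finset (Fin n) // s.card = k} F :=
  Matrix.of fun I J => symProd H (fun i => siteFactor Z H (enum J.1 J.2 i)) (T I)

theorem prod_subsets_enum (hk1 : 1 ≤ k) (h : Fin n → F) :
    ∏ J : {s : Finset (Fin n) // s.card = k}, ∏ i, h (enum J.1 J.2 i) =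
      (∏ c, h c) ^ (n - 1).choose (k - 1) := by
  simp only [prod_enum]
  rw [← Finset.prod_pow]
  have hcard : ∏ c, h c ^ (n - 1).choose (k - 1) = ∏ c, h c ^
      (Finset.univ.filter (fun J : {s : Finset (Fin n) // s.card = k} => c ∈ J.1)).card :=
    Finset.prod_congr rfl fun c _ => by rw [card_subsets_containing hk1]
  rw [hcard]
  rw [← prod_prod_ite_eq_pow (fun (J : {s : Finset (Fin n) // s.card = k}) i => i ∈ J.1)]
  refine Finset.prod_congr rfl fun J _ => ?_
  rw [← Finset.prod_filter]
  simp

theorem det_weightMatrix_self (hk1 : 1 ≤ k) (Z : Fin n → F) (H : F) (hZ : ∀ a, Z a ≠ 0) :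
    (weightMatrix (k := k) Z H fun I i => Z (enum I.1 I.2 i)).det =
      (∏ c, siteFactor Z H c (Z c)) ^ (n - 1).choose (k - 1) *
        ∏ J : {s : Finset (Fin n) // s.card = k}, interaction H (Z ∘ enum J.1 J.2) := by
  rw [det_eq_prod_diag_of_grading _ fun I => -∑ i, ((enum I.1 I.2 i : ℕ) : ℤ)]
  · rw [← prod_subsets_enum hk1 (fun c => siteFactor Z H c (Z c)), ← Finset.prod_mul_distrib]
    exact Finset.prod_congr rfl fun J _ =>
      symProd_siteFactor_self Z H hZ (enum_strictMono J.1 J.2)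
  · intro I J hne
    rw [weightMatrix, Matrix.of_apply] at hne
    obtain ⟨σ, hσ⟩ := exists_perm_of_symProd_ne_zero hne
    refine (eq_or_sum_lt_of_comp_perm_le (enum_strictMono J.1 J.2) (enum_strictMono I.1 I.2) σ
      fun i => ?_).imp enum_injective neg_lt_neg
    by_contra hi
    exact hσ i (siteFactor_self_eq_zero Z H (not_le.1 hi) (hZ _))

theorem det_weightMatrix_scaled (hk1 : 1 ≤ k) (Z : Fin n → F) {H : F} (hH : H ≠ 0)
    (hZ : ∀ a, Z a ≠ 0) :
    (weightMatrix (k := k) Z H fun I i => H * Z (enum I.1 I.2 i)).det =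
      (∏ c, siteFactor Z H c (H * Z c)) ^ (n - 1).choose (k - 1) *
        ∏ J : {s : Finset (Fin n) // s.card = k}, interaction H (Z ∘ enum J.1 J.2) := by
  rw [det_eq_prod_diag_of_grading _ fun I => ∑ i, ((enum I.1 I.2 i : ℕ) : ℤ)]
  · rw [← prod_subsets_enum hk1 (fun c => siteFactor Z H c (H * Z c)), ← Finset.prod_mul_distrib]
    exact Finset.prod_congr rfl fun J _ =>
      symProd_siteFactor_scaled Z hH hZ (enum_strictMono J.1 J.2)
  · intro I J hne
    rw [weightMatrix, Matrix.of_apply] at hne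
    obtain ⟨σ, hσ⟩ := exists_perm_of_symProd_ne_zero hne
    refine (eq_or_sum_lt_of_le_comp_perm (enum_strictMono J.1 J.2) (enum_strictMono I.1 I.2) σ
      fun i => ?_).imp_left enum_injective
    by_contra hi
    exact hσ i (siteFactor_scaled_eq_zero Z (not_le.1 hi) (hZ _) hH)

/-- The weight functions with reordered parameters are combinations, with coefficients that do
not depend on the variables, of those in the given order. -/
theorem exists_weight_expansion (hk : k ≤ n) (Z : Fin n → F) (H : F)
    (hZH : ∀ a b, a ≠ b → Z b ≠ H * Z a) :
    ∃ A : Matrix {s : Finset (Fin n) // s.card = k} {s : Finset (Fin n) // s.card = k} F,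
      ∀ T : {s : Finset (Fin n) // s.card = k} → GenericTuple F k,
        (Matrix.of fun I J : {s : Finset (Fin n) // s.card = k} =>
          W0 n k (T I).1 (Z ∘ permOfSubset hk J.1 J.2) H) =
          weightMatrix Z H (fun I => (T I).1) * A := by
  have hrange : weightSpan k Z H = Submodule.span F
      (Set.range fun K : {s : Finset (Fin n) // s.card = k} => weightFun Z H (enum K.1 K.2)) := by
    unfold weightSpan
    congr 1
    ext f
    constructor
    · rintro ⟨K, rfl⟩
      obtain ⟨I, hI⟩ := exists_eq_enum K.2
      exact ⟨I, by simp only [hI]⟩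
    · rintro ⟨I, rfl⟩
      exact ⟨⟨_, enum_strictMono I.1 I.2⟩, rfl⟩
  have hmem : ∀ J : {s : Finset (Fin n) // s.card = k},
      ∃ c : {s : Finset (Fin n) // s.card = k} → F,
        ∑ K, c K • weightFun Z H (enum K.1 K.2) =
          weightFun (Z ∘ permOfSubset hk J.1 J.2) H (Fin.castLE hk) := by
    intro J
    rw [← Submodule.mem_span_range_iff_exists_fun, ← hrange]
    exact weightSpan_comp_perm_le k Z H hZH _
      (weightFun_mem_weightSpan _ _ (Fin.strictMono_castLE hk))
  choose c hc using hmem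
  refine ⟨Matrix.of fun K J => c J K, fun T => ?_⟩
  ext I J
  rw [Matrix.mul_apply, Matrix.of_apply, W0_eq_symProd hk]
  have := congrFun (hc J) (T I)
  rw [Finset.sum_apply] at this
  refine this.symm.trans (Finset.sum_congr rfl fun K _ => ?_)
  exact mul_comm _ _

theorem det_W0_matrix (hk1 : 1 ≤ k) (hk : k ≤ n) (Z : Fin n → F) {H : F} (hH : H ≠ 0)
    (hZ : ∀ a, Z a ≠ 0) (hinj : Function.Injective Z)
    (hZH : ∀ a b, a ≠ b → Z b ≠ H * Z a) :
    (Matrix.of fun I J : {s : Finset (Fin n) // s.card = k} =>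
        W0 n k (fun a => H * Z (enum I.1 I.2 a)) (Z ∘ permOfSubset hk J.1 J.2) H).det =
      H ^ (-((n * (n - 1) / 2 * Nat.choose (n - 1) (k - 1) : ℕ) : ℤ)) * Dhat n k Z H := by
  obtain ⟨A, hA⟩ := exists_weight_expansion hk Z H hZH
  have hself := hA fun I => ⟨fun i => Z (enum I.1 I.2 i),
    hinj.comp (enum_strictMono I.1 I.2).injective, fun _ => hZ _⟩
  have hscaled := hA fun I => ⟨fun i => H * Z (enum I.1 I.2 i),
    (mul_right_injective₀ hH).comp (hinj.comp (enum_strictMono I.1 I.2).injective),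
    fun _ => mul_ne_zero hH (hZ _)⟩
  have hdiag : (Matrix.of fun I J : {s : Finset (Fin n) // s.card = k} =>
      W0 n k (fun i => Z (enum I.1 I.2 i)) (Z ∘ permOfSubset hk J.1 J.2) H).det =
      Dhat n k Z H := by
    rw [det_eq_prod_diag_of_grading _ fun _ => 0, ← prod_subsets_diag hk1]
    · refine Finset.prod_congr rfl fun J _ => ?_
      rw [Matrix.of_apply, W0_eq_symProd hk, symProd_permOfSubset_self hk Z H hZ hinj]
    · intro I J hne
      rw [Matrix.of_apply, W0_eq_symProd hk] at hne
      left
      by_contra hIJ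
      exact hne (symProd_permOfSubset_eq_zero hk Z H hZ hIJ)
  have h1 := congrArg Matrix.det hself
  rw [Matrix.det_mul, det_weightMatrix_self hk1 Z H hZ] at h1
  rw [← hdiag]
  refine (congrArg Matrix.det hscaled).trans ?_
  refine Eq.trans ?_ (congrArg _ h1.symm)
  rw [Matrix.det_mul, det_weightMatrix_scaled hk1 Z hH hZ, ← prod_siteFactor_scaled Z hH hZ,
    mul_pow, ← pow_mul, zpow_neg, zpow_natCast]
  field_simp

end WeightFunctions

theorem HV_ne_zero (n : ℕ) : HV n ≠ 0 := by
  unfold HV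
  rw [Ne, FaithfulSMul.algebraMap_eq_zero_iff]
  exact X_ne_zero _

theorem ZV_ne_zero (n : ℕ) (a : Fin n) : ZV n a ≠ 0 := by
  unfold ZV
  rw [Ne, FaithfulSMul.algebraMap_eq_zero_iff]
  exact X_ne_zero _

theorem ZV_injective (n : ℕ) : Function.Injective (ZV n) :=
  (FaithfulSMul.algebraMap_injective _ _).comp ((X_injective).comp Sum.inl_injective)

theorem ZV_ne_HV_mul_ZV (n : ℕ) (a b : Fin n) : ZV n b ≠ HV n * ZV n a := by
  unfold ZV HV
  rw [← map_mul]
  intro h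
  have h' := congrArg totalDegree (FaithfulSMul.algebraMap_injective _ _ h)
  rw [totalDegree_mul_of_isDomain (X_ne_zero _) (X_ne_zero _)] at h'
  simp at h'

/-- Proposition 3.5, first formula:
`det (𝒲⁰(H·Z_I; Z_{σ_J}; H))_{I,J} = H^{−(n(n−1)/2)·binom(n−1,k−1)} D̂(Z;H)`. -/
theorem det_trig_weight_matrix (n k : ℕ) (hk1 : 1 ≤ k) (hk : k ≤ n) :
    (Matrix.of fun I J : {s : Finset (Fin n) // s.card = k} =>
        W0 n k (fun a => HV n * ZV n (enum I.1 I.2 a))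
          (ZV n ∘ permOfSubset hk J.1 J.2) (HV n)).det
      = HV n ^ (-((n * (n - 1) / 2 * Nat.choose (n - 1) (k - 1) : ℕ) : ℤ)) *
          Dhat n k (ZV n) (HV n) := by
  exact det_W0_matrix hk1 hk (ZV n) (HV_ne_zero n) (ZV_ne_zero n) (ZV_injective n)
    fun a b _ => ZV_ne_HV_mul_ZV n a b

end
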